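/- arXiv:math/0509499 — 3 statements merged into one kernel-verified Lean document; each statement's English description precedes it below -/
import Mathlib

section
/- Let n be an integer and let Δ_n(T) = -n·T + (2n+1) - n·T⁻¹ in the ring ℤ[T,T⁻¹] of Laurent polynomials over ℤ. Then there exist a Laurent polynomial F ∈ ℤ[T,T⁻¹], an integer k, and a sign ε ∈ {1,-1} such that Δ_n(T) = ε · T^k · F(T) · F(T⁻¹) if and only if there exists an integer b with n = b(b+1). (This is the Fox–Milnor factorization criterion applied to the Alexander polynomial of the n-twisted positive Whitehead double; the paper uses it to conclude that D_+(K,n) is not slice, hence not quasipositive, when n ≠ b(b±1).) -/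
open LaurentPolynomial

/-- Since `-1` is its own inverse, evaluating at `-1` is insensitive to `T ↦ T⁻¹`. -/
theorem LaurentPolynomial.eval₂_neg_one_invert {R S : Type*} [CommSemiring R] [CommRing S]
    (f : R →+* S) (p : LaurentPolynomial R) :
    eval₂ f (-1 : Sˣ) (invert p) = eval₂ f (-1 : Sˣ) p := by
  induction p using LaurentPolynomial.induction_on' with
  | add p q hp hq => rw [map_add, map_add, map_add, hp, hq]
  | C_mul_T n a =>
    rw [map_mul, invert_C, invert_T, eval₂_C_mul_T, eval₂_C_mul_T, zpow_neg, ← inv_zpow, inv_neg_one]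

/-- If `4n + 1` is a square up to sign, then `n` is a product of consecutive integers. -/
theorem Int.exists_eq_mul_add_one_of_sq {n m : ℤ}
    (h : 4 * n + 1 = m ^ 2 ∨ 4 * n + 1 = -m ^ 2) : ∃ b : ℤ, n = b * (b + 1) := by
  obtain ⟨b, rfl | rfl⟩ := Int.even_or_odd' m
  · ring_nf at h
    omega
  · refine ⟨b, ?_⟩
    ring_nf at h ⊢
    omega

/-- **Fox–Milnor criterion for the Alexander polynomial of the `n`-twisted
positive Whitehead double.**  The Laurent polynomial
`Δ_n(T) = -n·T + (2n+1) - n·T⁻¹` admits a factorization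
`Δ_n(T) = ε · T^k · F(T) · F(T⁻¹)` with `ε ∈ {1, -1}` if and only if
`n = b(b+1)` for some integer `b`.  Here `invert` is the ring involution of
`ℤ[T,T⁻¹]` sending `T` to `T⁻¹`. -/
theorem foxMilnor_whitehead_double (n : ℤ) :
    (∃ (F : LaurentPolynomial ℤ) (k ε : ℤ), (ε = 1 ∨ ε = -1) ∧
      -C n * T 1 + C (2 * n + 1) - C n * T (-1) = C ε * T k * F * invert F) ↔
    ∃ b : ℤ, n = b * (b + 1) := by
  constructor
  · rintro ⟨F, k, ε, hε, h⟩
    apply Int.exists_eq_mul_add_one_of_sq (m := eval₂ (RingHom.id ℤ) (-1 : ℤˣ) F)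
    have key := congrArg (eval₂ (RingHom.id ℤ) (-1 : ℤˣ)) h
    simp only [map_sub, map_add, map_mul, map_neg, eval₂_neg_one_invert, eval₂_C, eval₂_T,
      RingHom.id_apply, zpow_one, zpow_neg, inv_neg_one, Units.val_neg, Units.val_one] at key
    rcases hε with rfl | rfl <;> rcases Int.units_eq_one_or ((-1 : ℤˣ) ^ k) with hk | hk <;>
      rw [hk] at key <;> push_cast at key
    · left; linarith
    · right; linarith
    · right; linarith
    · left; linarith
  · rintro ⟨b, rfl⟩
    refine ⟨C (b + 1) * T 1 - C b, 0, 1, Or.inl rfl, ?_⟩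
    have hT : (T 1 : LaurentPolynomial ℤ) * T (-1) = 1 := by rw [← T_add, add_neg_cancel, T_zero]
    simp only [map_sub, map_add, map_mul, map_one, invert_C, invert_T, T_zero, map_ofNat]
    linear_combination (-(C b + 1) ^ 2) * hT
end

section
/- Let n be an integer and suppose F ∈ ℤ[T,T⁻¹] is a Laurent polynomial with F(T) · F(T⁻¹) = -n·T + (2n+1) - n·T⁻¹ in ℤ[T,T⁻¹]. Then there exists an integer b with n = b(b+1). -/
open LaurentPolynomial

/-- Evaluating `F(T⁻¹)` at a unit `x` is the same as evaluating `F` at `x⁻¹`. -/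
theorem eval₂_invert {R S : Type*} [CommSemiring R] [CommSemiring S] (f : R →+* S) (x : Sˣ)
    (F : LaurentPolynomial R) :
    LaurentPolynomial.eval₂ f x (invert F) = LaurentPolynomial.eval₂ f x⁻¹ F := by
  induction F using LaurentPolynomial.induction_on' with
  | add p q hp hq => simp only [map_add, hp, hq]
  | C_mul_T n a => simp only [map_mul, invert_C, invert_T, eval₂_C, eval₂_T, inv_zpow, zpow_neg]

/-- If a Laurent polynomial `F ∈ ℤ[T,T⁻¹]` satisfies
`F(T) · F(T⁻¹) = -n·T + (2n+1) - n·T⁻¹`, then `n = b(b+1)` for some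
integer `b`.  Here `invert` is the ring involution of `ℤ[T,T⁻¹]` sending
`T` to `T⁻¹`. -/
theorem whitehead_double_alexander_factor (n : ℤ) (F : LaurentPolynomial ℤ)
    (h : F * invert F = -C n * T 1 + C (2 * n + 1) - C n * T (-1)) :
    ∃ b : ℤ, n = b * (b + 1) := by
  have key := congrArg (LaurentPolynomial.eval₂ (RingHom.id ℤ) (-1)) h
  simp only [map_mul, map_add, map_sub, map_neg, eval₂_invert, inv_neg, inv_one, eval₂_C,
    eval₂_T, RingHom.id_apply, zpow_one, zpow_neg, Units.val_neg, Units.val_one] at key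
  set m : ℤ := LaurentPolynomial.eval₂ (RingHom.id ℤ) (-1) F
  obtain ⟨b, hb | hb⟩ := Int.even_or_odd' m
  · rw [hb] at key
    ring_nf at key
    omega
  · refine ⟨b, ?_⟩
    rw [hb] at key
    norm_num at key
    linarith
end

section
/- Let n be a nonzero integer and suppose F ∈ ℤ[T,T⁻¹] satisfies F(T) · F(T⁻¹) = -n·T + (2n+1) - n·T⁻¹ in ℤ[T,T⁻¹]. Then there exist an integer k and integers a, b with F(T) = a·T^k + b·T^(k+1), and these coefficients satisfy a·b = -n and a² + b² = 2n + 1. -/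
open LaurentPolynomial

theorem LaurentPolynomial.coeff_mul_invert {R : Type*} [CommSemiring R]
    (f g : LaurentPolynomial R) (d : ℤ) :
    (f * invert g).coeff d = f.coeff.sum fun i r => r * g.coeff (i - d) := by
  rw [AddMonoidAlgebra.coeff_mul_apply_left]
  simp [sub_eq_add_neg, add_comm]

/-- Degree-span step in the Fox–Milnor analysis: if `n ≠ 0` and
`F ∈ ℤ[T,T⁻¹]` satisfies `F(T) · F(T⁻¹) = -n·T + (2n+1) - n·T⁻¹`, then
`F = a·T^k + b·T^(k+1)` for some integers `k, a, b` with `a·b = -n` and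
`a² + b² = 2n + 1`.  Here `invert` is the ring involution of `ℤ[T,T⁻¹]`
sending `T` to `T⁻¹`. -/
theorem whitehead_double_factor_support (n : ℤ) (hn : n ≠ 0)
    (F : LaurentPolynomial ℤ)
    (h : F * invert F = -C n * T 1 + C (2 * n + 1) - C n * T (-1)) :
    ∃ (k a b : ℤ), F = C a * T k + C b * T (k + 1) ∧
      a * b = -n ∧ a ^ 2 + b ^ 2 = 2 * n + 1 := by
  have coeff_C_mul_T (a k j : ℤ) :
      (C a * T k : LaurentPolynomial ℤ).coeff j = if k = j then a else 0 := by
    rw [← single_eq_C_mul_T, AddMonoidAlgebra.coeff_single, Finsupp.single_apply]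
  have hc (d : ℤ) : (∑ i ∈ F.coeff.support, F.coeff i * F.coeff (i - d)) =
      -(if 1 = d then n else 0) + (if d = 0 then 2 * n + 1 else 0)
        - (if -1 = d then n else 0) := by
    have := coeff_mul_invert F F d
    rw [h, Finsupp.sum] at this
    rw [← this, neg_mul, AddMonoidAlgebra.coeff_sub, AddMonoidAlgebra.coeff_add,
      AddMonoidAlgebra.coeff_neg, Finsupp.sub_apply, Finsupp.add_apply, Finsupp.neg_apply,
      coeff_C_mul_T, coeff_C_mul_T, C_apply]
  have hne : F.coeff.support.Nonempty := by
    rw [Finset.nonempty_iff_ne_empty]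
    intro he
    have := hc 1
    rw [he] at this
    simp at this
    exact hn this
  set M := F.coeff.support.max' hne
  set m := F.coeff.support.min' hne
  have hM : F.coeff M ≠ 0 := Finsupp.mem_support_iff.mp (Finset.max'_mem _ hne)
  have hm : F.coeff m ≠ 0 := Finsupp.mem_support_iff.mp (Finset.min'_mem _ hne)
  have le_M (i : ℤ) (hi : i ∈ F.coeff.support) : i ≤ M := Finset.le_max' _ i hi
  have m_le (i : ℤ) (hi : F.coeff i ≠ 0) : m ≤ i :=
    Finset.min'_le _ i (Finsupp.mem_support_iff.mpr hi)
  have hmM : m ≤ M := m_le M hM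
  have hspan : (∑ i ∈ F.coeff.support, F.coeff i * F.coeff (i - (M - m))) =
      F.coeff M * F.coeff m := by
    rw [Finset.sum_eq_single M]
    · congr 2; ring
    · intro i hi hiM
      have := le_M i hi
      rw [mul_eq_zero]
      right
      by_contra h0
      have := m_le _ h0
      omega
    · intro hi
      rw [Finsupp.notMem_support_iff.mp hi, zero_mul]
  have hle : M ≤ m + 1 := by
    by_contra! hlt
    rw [hc, if_neg (by omega), if_neg (by omega), if_neg (by omega)] at hspan
    exact mul_ne_zero hM hm (by linarith)
  have hF : F = C (F.coeff m) * T m + C (F.coeff (m + 1)) * T (m + 1) := by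
    ext j
    rw [AddMonoidAlgebra.coeff_add, Finsupp.add_apply, coeff_C_mul_T, coeff_C_mul_T]
    by_cases hj : F.coeff j = 0
    · grind
    · have := m_le j hj
      have := le_M j (Finsupp.mem_support_iff.mpr hj)
      grind
  have hsub : F.coeff.support ⊆ {m, m + 1} := by
    intro j hj
    have := m_le j (Finsupp.mem_support_iff.mp hj)
    have := le_M j hj
    simp only [Finset.mem_insert, Finset.mem_singleton]
    omega
  have hpair (d : ℤ) : (∑ i ∈ F.coeff.support, F.coeff i * F.coeff (i - d)) =
      F.coeff m * F.coeff (m - d) + F.coeff (m + 1) * F.coeff (m + 1 - d) := by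
    rw [Finset.sum_subset hsub, Finset.sum_pair (by omega)]
    intro i _ hi
    rw [Finsupp.notMem_support_iff.mp hi, zero_mul]
  have hbelow : F.coeff (m - 1) = 0 := by
    by_contra h0
    have := m_le _ h0
    omega
  have h0 := (hpair 0).symm.trans (hc 0)
  have h1 := (hpair 1).symm.trans (hc 1)
  simp [hbelow] at h0 h1
  exact ⟨m, F.coeff m, F.coeff (m + 1), hF, by linarith, by linarith⟩
end
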